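/- Fix a natural number g ≥ 2. There exists a constant C > 0 such that for every natural number n ≥ 1 with gcd(g+1, 2^n − 1) = 1, letting F be the field with 2^n elements, the set of monic polynomials in F[x] of degree at most g+1 has at most C·2^{n(g−2)} equivalence classes under the equivalence relation f ∼ h defined by: there exist A ∈ GL₂(F) and λ ∈ Fˣ with h = λ·ψ_{g+1}(A)(f). -/

import Mathlib

open Polynomial

/-- The twisted Möbius action of a 2×2 matrix on polynomials of degree at most `m`:
`ψ_m(A)(f) = Σ_{i=0}^{m} f_i (a x + b)^i (c x + d)^{m-i}`. -/
noncomputable def psi {F : Type*} [Field F] (m : ℕ) (A : Matrix (Fin 2) (Fin 2) F)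
    (f : Polynomial F) : Polynomial F :=
  ∑ i ∈ Finset.range (m + 1),
    C (f.coeff i) * (C (A 0 0) * X + C (A 0 1)) ^ i *
      (C (A 1 0) * X + C (A 1 1)) ^ (m - i)

/-- `f ∼ h` iff `h = λ·ψ_{g+1}(A)(f)` for some `A ∈ GL₂(F)`, `λ ∈ Fˣ`. -/
def psiEquiv (g : ℕ) {F : Type*} [Field F]
    (f h : {f : Polynomial F // f.Monic ∧ f.natDegree ≤ g + 1}) : Prop :=
  ∃ A : GL (Fin 2) F, ∃ lam : Fˣ,
    (h : Polynomial F) =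
      (lam : F) • psi (g + 1) (A : Matrix (Fin 2) (Fin 2) F) (f : Polynomial F)


open OnePoint

section Evaluation

variable {F : Type*} [Field F]

lemma natDegree_linear_pow_mul_le {m i : ℕ} (hi : i ≤ m) (a b c d e : F) :
    (C e * (C a * X + C b) ^ i * (C c * X + C d) ^ (m - i)).natDegree ≤ m := by
  have h1 : ((C a * X + C b) ^ i).natDegree ≤ i := by
    simpa using natDegree_pow_le_of_le i (natDegree_linear_le (a := a) (b := b))
  have h2 : ((C c * X + C d) ^ (m - i)).natDegree ≤ m - i := by
    simpa using natDegree_pow_le_of_le (m - i) (natDegree_linear_le (a := c) (b := d))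
  have h3 := natDegree_mul_le_of_le ((natDegree_C_mul_le e _).trans h1) h2
  omega

lemma natDegree_psi_le (m : ℕ) (A : Matrix (Fin 2) (Fin 2) F) (f : F[X]) :
    (psi m A f).natDegree ≤ m :=
  natDegree_sum_le_of_forall_le _ _ fun i hi =>
    natDegree_linear_pow_mul_le (by simpa [Nat.lt_succ_iff] using hi) _ _ _ _ _

lemma coeff_psi_top (m : ℕ) (A : Matrix (Fin 2) (Fin 2) F) (f : F[X]) :
    (psi m A f).coeff m =
      ∑ i ∈ Finset.range (m + 1), f.coeff i * A 0 0 ^ i * A 1 0 ^ (m - i) := by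
  rw [psi, finsetSum_coeff]
  refine Finset.sum_congr rfl fun i hi => ?_
  have hi : i ≤ m := by simpa [Nat.lt_succ_iff] using hi
  have h1 : ((C (A 0 0) * X + C (A 0 1)) ^ i).natDegree ≤ i := by
    simpa using natDegree_pow_le_of_le i (natDegree_linear_le (a := A 0 0) (b := A 0 1))
  have h2 : ((C (A 1 0) * X + C (A 1 1)) ^ (m - i)).natDegree ≤ m - i := by
    simpa using natDegree_pow_le_of_le (m - i) (natDegree_linear_le (a := A 1 0) (b := A 1 1))
  have key := coeff_mul_add_eq_of_natDegree_le h1 h2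
  rw [Nat.add_sub_cancel' hi] at key
  have k1 := coeff_pow_of_natDegree_le (n := 1) (m := i)
    (natDegree_linear_le (a := A 0 0) (b := A 0 1))
  have k2 := coeff_pow_of_natDegree_le (n := 1) (m := m - i)
    (natDegree_linear_le (a := A 1 0) (b := A 1 1))
  simp only [mul_one] at k1 k2
  rw [mul_assoc, coeff_C_mul, key, k1, k2]
  simp [mul_assoc]

lemma psi_eq_pow_smul_of_eq_mul (m : ℕ) {A B : Matrix (Fin 2) (Fin 2) F} {s : F}
    (h : ∀ i j, B i j = s * A i j) (f : F[X]) : psi m B f = C (s ^ m) * psi m A f := by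
  rw [psi, psi, Finset.mul_sum]
  refine Finset.sum_congr rfl fun i hi => ?_
  have hi : i ≤ m := by simpa [Nat.lt_succ_iff] using hi
  simp only [h]
  rw [← Nat.add_sub_cancel' hi, pow_add, Nat.add_sub_cancel_left]
  have e1 : C (s * A 0 0) * X + C (s * A 0 1) = C s * (C (A 0 0) * X + C (A 0 1)) := by
    simp only [C_mul]; ring
  have e2 : C (s * A 1 0) * X + C (s * A 1 1) = C s * (C (A 1 0) * X + C (A 1 1)) := by
    simp only [C_mul]; ring
  rw [e1, e2, mul_pow, mul_pow]
  simp only [C_mul, C_pow]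
  ring

lemma psi_affine {m : ℕ} {f : F[X]} (hf : f.natDegree ≤ m) (u s : F) :
    psi m !![u, s; 0, 1] f = f.comp (C u * X + C s) := by
  rw [comp, eval₂_eq_sum_range' C (Nat.lt_succ_of_le hf), psi]
  exact Finset.sum_congr rfl fun i _ => by simp

variable {K : Type*} [Field K] [Algebra F K]

lemma aeval_eq_sum_of_natDegree_le {m : ℕ} {f : F[X]} (hf : f.natDegree ≤ m) (x : K) :
    aeval x f = ∑ i ∈ Finset.range (m + 1), algebraMap F K (f.coeff i) * x ^ i := by
  rw [aeval_def, eval₂_eq_sum_range' _ (Nat.lt_succ_of_le hf)]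

/-- The homogenization of `f` in degree `m`, evaluated at `(u, v)`. -/
noncomputable def formEval (K : Type*) [Field K] [Algebra F K] (m : ℕ) (f : F[X]) (u v : K) : K :=
  ∑ i ∈ Finset.range (m + 1), algebraMap F K (f.coeff i) * u ^ i * v ^ (m - i)

lemma formEval_mul (m : ℕ) (f : F[X]) (w u v : K) :
    formEval K m f (w * u) (w * v) = w ^ m * formEval K m f u v := by
  rw [formEval, formEval, Finset.mul_sum]
  refine Finset.sum_congr rfl fun i hi => ?_
  have hi : i ≤ m := by simpa [Nat.lt_succ_iff] using hi
  rw [← Nat.add_sub_cancel' hi, pow_add, Nat.add_sub_cancel_left]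
  ring

lemma formEval_one {m : ℕ} {f : F[X]} (hf : f.natDegree ≤ m) (u : K) :
    formEval K m f u 1 = aeval u f := by
  simp [formEval, aeval_eq_sum_of_natDegree_le hf]

lemma formEval_zero (m : ℕ) (f : F[X]) (u : K) :
    formEval K m f u 0 = algebraMap F K (f.coeff m) * u ^ m := by
  rw [formEval, Finset.sum_range_succ, Finset.sum_eq_zero]
  · simp
  · intro i hi
    have : m - i ≠ 0 := by have := Finset.mem_range.1 hi; omega
    simp [this]

lemma aeval_psi (m : ℕ) (A : Matrix (Fin 2) (Fin 2) F) (f : F[X]) (t : K) :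
    aeval t (psi m A f) = formEval K m f
      (algebraMap F K (A 0 0) * t + algebraMap F K (A 0 1))
      (algebraMap F K (A 1 0) * t + algebraMap F K (A 1 1)) := by
  simp [psi, formEval]

lemma algebraMap_coeff_psi_top (m : ℕ) (A : Matrix (Fin 2) (Fin 2) F) (f : F[X]) :
    algebraMap F K ((psi m A f).coeff m) =
      formEval K m f (algebraMap F K (A 0 0)) (algebraMap F K (A 1 0)) := by
  simp [coeff_psi_top, formEval]

/-- A point of the projective line over `K` is a root of `f`, seen as a form of degree `m`. -/
def IsProjRoot (m : ℕ) (f : F[X]) (x : OnePoint K) : Prop :=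
  (∃ t : K, x = t ∧ aeval t f = 0) ∨ (x = ∞ ∧ f.coeff m = 0)

@[simp] lemma isProjRoot_coe {m : ℕ} {f : F[X]} {t : K} :
    IsProjRoot m f (t : OnePoint K) ↔ aeval t f = 0 := by
  simp [IsProjRoot]

@[simp] lemma isProjRoot_infty {m : ℕ} {f : F[X]} :
    IsProjRoot m f (∞ : OnePoint K) ↔ f.coeff m = 0 := by
  simp [IsProjRoot]

lemma setOf_isProjRoot_finite {f : F[X]} (hf : f ≠ 0) (m : ℕ) :
    {x : OnePoint K | IsProjRoot m f x}.Finite := by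
  refine (((f.rootSet_finite K).image ((↑) : K → OnePoint K)).insert ∞).subset fun x hx => ?_
  rcases hx with ⟨t, rfl, ht⟩ | ⟨rfl, -⟩
  · exact Or.inr ⟨t, (mem_rootSet.2 ⟨hf, ht⟩), rfl⟩
  · exact Or.inl rfl

lemma ncard_setOf_isProjRoot_le {f : F[X]} (hf : f ≠ 0) {m : ℕ} (hm : f.natDegree ≤ m) :
    {x : OnePoint K | IsProjRoot m f x}.ncard ≤ m + 1 := by
  have h1 : (f.rootSet K).ncard ≤ m := (ncard_rootSet_le f K).trans hm
  have hfin := (f.rootSet_finite K).image ((↑) : K → OnePoint K)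
  refine (Set.ncard_le_ncard (t := insert ∞ ((↑) '' f.rootSet K)) (fun x hx => ?_)
    (hfin.insert ∞)).trans
    ((Set.ncard_insert_le _ _).trans (Nat.add_le_add_right
      ((Set.ncard_image_le (f.rootSet_finite K)).trans h1) 1))
  rcases hx with ⟨t, rfl, ht⟩ | ⟨rfl, -⟩
  · exact Or.inr ⟨t, (mem_rootSet.2 ⟨hf, ht⟩), rfl⟩
  · exact Or.inl rfl

variable [DecidableEq K]

lemma formEval_eq_zero_iff {m : ℕ} {f : F[X]} (hf : f.natDegree ≤ m) {u v : K}
    (h : v = 0 → u ≠ 0) :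
    formEval K m f u v = 0 ↔
      IsProjRoot m f (if v = 0 then ∞ else ((u / v : K) : OnePoint K)) := by
  split_ifs with hv
  · subst hv
    simp [formEval_zero, h rfl]
  · have : formEval K m f u v = v ^ m * aeval (u / v) f := by
      rw [← formEval_one hf, ← formEval_mul, mul_one, mul_div_cancel₀ _ hv]
    simp [this, hv]

lemma isProjRoot_psi_iff {m : ℕ} {f : F[X]} (hf : f.natDegree ≤ m) (A : GL (Fin 2) F)
    (x : OnePoint K) :
    IsProjRoot m (psi m (A : Matrix (Fin 2) (Fin 2) F) f) x ↔
      IsProjRoot m f (A.map (algebraMap F K) • x) := by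
  have hdet : algebraMap F K (A 0 0) * algebraMap F K (A 1 1) -
      algebraMap F K (A 0 1) * algebraMap F K (A 1 0) ≠ 0 := by
    have := A.det_ne_zero
    rw [Matrix.det_fin_two] at this
    rwa [← map_mul, ← map_mul, ← map_sub, Ne, FaithfulSMul.algebraMap_eq_zero_iff]
  cases x with
  | infty =>
    rw [isProjRoot_infty, smul_infty_eq_ite, ← FaithfulSMul.algebraMap_eq_zero_iff F K,
      algebraMap_coeff_psi_top, formEval_eq_zero_iff hf]
    · by_cases hc : algebraMap F K (A 1 0) = 0 <;> simp [hc, Matrix.GeneralLinearGroup.map_apply]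
    · rintro h1 h2
      simp [h1, h2] at hdet
  | coe t =>
    rw [isProjRoot_coe, smul_some_eq_ite, aeval_psi, formEval_eq_zero_iff hf]
    · simp
    · intro h1 h2
      refine hdet ?_
      by_cases hc : algebraMap F K (A 1 0) = 0
      · have : algebraMap F K (A 1 1) = 0 := by simpa [hc] using h1
        simp [hc, this]
      · apply mul_left_cancel₀ hc
        linear_combination algebraMap F K (A 1 0) * (algebraMap F K (A 0 0)) * h1 -
          algebraMap F K (A 1 0) * algebraMap F K (A 1 0) * h2

lemma psi_ne_zero [Infinite K] {m : ℕ} {f : F[X]} (hf : f.natDegree ≤ m) (hf0 : f ≠ 0)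
    (A : GL (Fin 2) F) : psi m (A : Matrix (Fin 2) (Fin 2) F) f ≠ 0 := by
  intro h0
  have hall : ∀ y : OnePoint K, IsProjRoot m f y := fun y => by
    have := (isProjRoot_psi_iff (K := K) hf A ((A.map (algebraMap F K))⁻¹ • y)).1 (by
      rw [h0]
      induction (A.map (algebraMap F K))⁻¹ • y using OnePoint.rec <;> simp)
    simpa using this
  have := (setOf_isProjRoot_finite (K := K) hf0 m)
  simp only [hall, Set.ofPred_true] at this
  exact Set.infinite_univ this

open scoped Classical in
lemma scalar_of_three_fixed_points {g : GL (Fin 2) K} {x : Fin 3 → OnePoint K}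
    (hx : Function.Injective x) (hg : ∀ i, g • x i = x i) :
    g.val ∈ Set.range (Matrix.scalar (Fin 2)) := by
  rw [← Matrix.GeneralLinearGroup.fixpointPolynomial_eq_zero_iff]
  let S : Finset (OnePoint K) := Finset.univ.image x
  have hS : S.card = 3 := by simp [S, Finset.card_image_of_injective _ hx]
  have hgS : ∀ y ∈ S, g • y = y := by simpa [S] using hg
  let T : Finset K := S.preimage (↑) OnePoint.coe_injective.injOn
  have hT : ∀ t ∈ T, eval t g.fixpointPolynomial = 0 := fun t ht => by
    have := Matrix.GeneralLinearGroup.fixpointPolynomial_aeval_eq_zero_iff.2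
      (hgS t (by simpa [T] using ht))
    simpa using this
  have hTS : T.map ⟨(↑), OnePoint.coe_injective⟩ = S.erase ∞ := by
    ext y
    cases y <;> simp [T]
  have hcard : T.card = (S.erase ∞).card := by rw [← hTS, Finset.card_map]
  by_cases hinf : ∞ ∈ S
  · have hc := smul_infty_eq_self_iff.1 (hgS _ hinf)
    rw [Finset.card_erase_of_mem hinf, hS] at hcard
    refine eq_zero_of_natDegree_lt_card_of_eval_eq_zero' _ T hT ?_
    rw [hcard, Matrix.GeneralLinearGroup.fixpointPolynomial, hc, C_0, zero_mul, zero_add]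
    refine lt_of_le_of_lt ?_ (by norm_num : 1 < 2)
    compute_degree
  · rw [Finset.erase_eq_of_notMem hinf, hS] at hcard
    refine eq_zero_of_natDegree_lt_card_of_eval_eq_zero' _ T hT ?_
    rw [hcard, Matrix.GeneralLinearGroup.fixpointPolynomial]
    refine lt_of_le_of_lt ?_ (by norm_num : 2 < 3)
    compute_degree

lemma eq_mul_of_smul_eq_of_three {A B : GL (Fin 2) F} {x : Fin 3 → OnePoint K}
    (hx : Function.Injective x)
    (h : ∀ i, (A.map (algebraMap F K))⁻¹ • x i = (B.map (algebraMap F K))⁻¹ • x i) :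
    ∃ s : F, ∀ i j, B i j = s * A i j := by
  have hfix : ∀ i, (B * A⁻¹).map (algebraMap F K) • x i = x i := fun i => by
    rw [map_mul, map_inv, mul_smul, h, smul_inv_smul]
  obtain ⟨t, ht⟩ := scalar_of_three_fixed_points hx hfix
  set M := B * A⁻¹ with hM
  have hentry : ∀ i j, algebraMap F K (M i j) = if i = j then t else 0 := fun i j => by
    have := congrFun (congrFun ht i) j
    simpa [Matrix.diagonal_apply] using this.symm
  have hBM : (B : Matrix (Fin 2) (Fin 2) F) = (M : Matrix (Fin 2) (Fin 2) F) * A := by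
    rw [← Units.val_mul, hM, inv_mul_cancel_right]
  have h01 : M 0 1 = 0 := (algebraMap F K).injective (by simp [hentry])
  have h10 : M 1 0 = 0 := (algebraMap F K).injective (by simp [hentry])
  have h11 : M 1 1 = M 0 0 := (algebraMap F K).injective (by simp [hentry])
  refine ⟨M 0 0, fun i j => ?_⟩
  rw [hBM, Matrix.mul_apply, Fin.sum_univ_two]
  fin_cases i <;> simp [h01, h10, h11]

end Evaluation

section TwoRoots

variable {F : Type*} [Field F]

lemma eq_pow_mul_pow_of_irreducible_factors {p q f : F[X]} (hf : f.Monic)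
    (h : ∀ r : F[X], r.Monic → Irreducible r → r ∣ f → r = p ∨ r = q) :
    ∃ i j : ℕ, f = p ^ i * q ^ j := by
  induction hn : f.natDegree using Nat.strong_induction_on generalizing f with
  | _ n ih =>
    by_cases hu : IsUnit f
    · exact ⟨0, 0, by simpa using hf.isUnit_iff.1 hu⟩
    · obtain ⟨r, hr, hirr, g, rfl⟩ := exists_monic_irreducible_factor f hu
      have hg : g.Monic := hr.of_mul_monic_left hf
      have hdeg := hr.natDegree_mul hg
      have hpos := hirr.natDegree_pos
      obtain ⟨i, j, hij⟩ := ih g.natDegree (by omega) hg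
        (fun s hs hs' hd => h s hs hs' (hd.mul_left r)) rfl
      rcases h r hr hirr (dvd_mul_right r g) with rfl | rfl
      · exact ⟨i + 1, j, by rw [hij]; ring⟩
      · exact ⟨i, j + 1, by rw [hij]; ring⟩

variable {K : Type*} [Field K] [Algebra F K]

lemma eq_of_monic_irreducible_of_aeval_eq_zero {p q : F[X]} (hp : p.Monic) (hq : q.Monic)
    (hp' : Irreducible p) (hq' : Irreducible q) {t : K} (hpt : aeval t p = 0)
    (hqt : aeval t q = 0) : p = q := by
  rw [minpoly.eq_of_irreducible_of_monic hp' hpt hp, minpoly.eq_of_irreducible_of_monic hq' hqt hq]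

variable [IsAlgClosed K]

lemma ncard_rootSet_eq_natDegree_of_irreducible [PerfectField F] {p : F[X]}
    (hp : Irreducible p) : (p.rootSet K).ncard = p.natDegree := by
  rw [← Nat.card_coe_set_eq, Nat.card_eq_fintype_card]
  exact card_rootSet_eq_natDegree (PerfectField.separable_of_irreducible hp)
    (IsAlgClosed.splits _)

lemma exists_form_of_ncard_rootSet_le_two [PerfectField F] [CharP F 2] {f : F[X]} (hf : f.Monic)
    (h2 : (f.rootSet K).ncard ≤ 2) :
    (∃ (a b : F) (i j : ℕ), a ≠ b ∧ f = (X - C a) ^ i * (X - C b) ^ j) ∨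
      (∃ (b c : F) (k : ℕ), b ≠ 0 ∧ (f.rootSet K).ncard = 2 ∧
        f = (X ^ 2 + C b * X + C c) ^ k) := by
  have hsub : ∀ r : F[X], r ∣ f → r.rootSet K ⊆ f.rootSet K := fun r hr t ht =>
    mem_rootSet.2 ⟨hf.ne_zero, aeval_eq_zero_of_dvd_aeval_eq_zero hr (mem_rootSet.1 ht).2⟩
  have hfin := f.rootSet_finite K
  have hdeg : ∀ r : F[X], Irreducible r → r ∣ f → r.natDegree ≤ 2 := fun r hr hd => by
    rw [← ncard_rootSet_eq_natDegree_of_irreducible (K := K) hr]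
    exact (Set.ncard_le_ncard (hsub r hd) hfin).trans h2
  by_cases hq : ∃ p : F[X], p.Monic ∧ Irreducible p ∧ p ∣ f ∧ p.natDegree = 2
  · obtain ⟨p, hpm, hpi, hpd, hp2⟩ := hq
    have hN : (p.rootSet K).ncard = 2 := by
      rw [ncard_rootSet_eq_natDegree_of_irreducible hpi, hp2]
    have heq : p.rootSet K = f.rootSet K := Set.eq_of_subset_of_ncard_le (hsub p hpd)
      (by rw [hN]; exact h2) hfin
    obtain ⟨i, j, hij⟩ := eq_pow_mul_pow_of_irreducible_factors (p := p) (q := p) hf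
      (fun r hrm hri hrd => Or.inl (by
        have hne : (r.rootSet K).Nonempty := by
          rw [← Set.ncard_pos (r.rootSet_finite K), ncard_rootSet_eq_natDegree_of_irreducible hri]
          exact hri.natDegree_pos
        obtain ⟨t, ht⟩ := hne
        have htp : t ∈ p.rootSet K := heq ▸ hsub r hrd ht
        exact eq_of_monic_irreducible_of_aeval_eq_zero hrm hpm hri hpi (mem_rootSet.1 ht).2
          (mem_rootSet.1 htp).2))
    have hp : p = X ^ 2 + C (p.coeff 1) * X + C (p.coeff 0) := by
      have := hpm.as_sum
      rw [hp2, Finset.sum_range_succ, Finset.sum_range_one] at this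
      rw [this]
      simp
      ring
    refine Or.inr ⟨p.coeff 1, p.coeff 0, i + j, fun h0 => ?_, heq ▸ hN, ?_⟩
    · have hsep := PerfectField.separable_of_irreducible hpi
      have hder : derivative p = 0 := by
        rw [hp, h0]
        simp [one_add_one_eq_two, CharTwo.two_eq_zero]
      rw [Separable, hder, isCoprime_zero_right] at hsep
      exact hpi.not_isUnit hsep
    · rw [← hp, hij, pow_add]
  · push Not at hq
    have hlin : ∀ r : F[X], r.Monic → Irreducible r → r ∣ f →
        ∃ a : F, r = X - C a ∧ f.IsRoot a := fun r hrm hri hrd => by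
      have h1 : r.natDegree = 1 := by
        have := hdeg r hri hrd
        have := hq r hrm hri hrd
        have := hri.natDegree_pos
        omega
      refine ⟨-r.coeff 0, ?_, ?_⟩
      · rw [C_neg, sub_neg_eq_add]
        exact hrm.eq_X_add_C h1
      · refine IsRoot.dvd ?_ hrd
        have h0 := congrArg (eval (-r.coeff 0)) (hrm.eq_X_add_C h1)
        simpa using h0
    have hab : ∃ a b : F, a ≠ b ∧ ∀ c, f.IsRoot c → c = a ∨ c = b := by
      by_contra! hcon
      obtain ⟨a, ha, -⟩ := hcon 0 1 zero_ne_one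
      obtain ⟨b, hb, hba, -⟩ := hcon a (a + 1) (by simp)
      obtain ⟨c, hc, hca, hcb⟩ := hcon a b hba.symm
      have hmem : ∀ d, f.IsRoot d → algebraMap F K d ∈ f.rootSet K := fun d hd =>
        mem_rootSet.2 ⟨hf.ne_zero, by rw [aeval_algebraMap_apply, coe_aeval_eq_eval, hd, map_zero]⟩
      have := (Set.two_lt_ncard_iff hfin).2 ⟨_, _, _, hmem a ha, hmem b hb, hmem c hc,
        fun h => hba ((algebraMap F K).injective h).symm,
        fun h => hca ((algebraMap F K).injective h).symm,
        fun h => hcb ((algebraMap F K).injective h).symm⟩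
      omega
    obtain ⟨a, b, hne, hab⟩ := hab
    obtain ⟨i, j, hij⟩ := eq_pow_mul_pow_of_irreducible_factors (p := X - C a) (q := X - C b) hf
      (fun r hrm hri hrd => by
        obtain ⟨c, rfl, hc⟩ := hlin r hrm hri hrd
        rcases hab c hc with rfl | rfl <;> simp)
    exact Or.inl ⟨a, b, i, j, hne, hij⟩

end TwoRoots

section NormalForms

variable {F : Type*} [Field F] {g : ℕ}

lemma mk_psiEquiv_eq_of_comp {f h : {f : F[X] // f.Monic ∧ f.natDegree ≤ g + 1}} {u s c : F}
    (hu : u ≠ 0) (hc : c ≠ 0) (hfh : C c * (h : F[X]) = (f : F[X]).comp (C u * X + C s)) :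
    Quot.mk (psiEquiv g) f = Quot.mk (psiEquiv g) h := by
  refine Quot.sound ⟨Matrix.GeneralLinearGroup.mkOfDetNeZero !![u, s; 0, 1] (by simpa),
    (Units.mk0 c hc)⁻¹, ?_⟩
  have : psi (g + 1) (Matrix.GeneralLinearGroup.mkOfDetNeZero !![u, s; 0, 1] (by simpa) :
      GL (Fin 2) F) (f : F[X]) = (f : F[X]).comp (C u * X + C s) := psi_affine f.2.2 u s
  rw [this, ← hfh, smul_eq_C_mul, ← mul_assoc, ← C_mul]
  simp [hc]

open scoped Classical in
/-- Representatives for the classes of monic polynomials of degree at most `m` which, as forms of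
degree `m`, have at most two zeros on the projective line over the algebraic closure. -/
noncomputable def twoRootForms (F : Type*) [Field F] [Fintype F] (m : ℕ) : Finset F[X] :=
  (Finset.range (m + 1) ×ˢ Finset.range (m + 1)).image (fun ij => X ^ ij.1 * (X - 1) ^ ij.2) ∪
    if 4 ≤ m then Finset.univ.image (fun c : F => (X ^ 2 + X + C c) ^ (m / 2)) else ∅

lemma card_twoRootForms_le [Fintype F] (m : ℕ) :
    (twoRootForms F m).card ≤ ((m + 1) ^ 2 + 1) * Fintype.card F ^ (m - 3) := by
  classical
  have hq : 1 ≤ Fintype.card F := Fintype.card_pos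
  have h1 : ((Finset.range (m + 1) ×ˢ Finset.range (m + 1)).image
      (fun ij : ℕ × ℕ => (X ^ ij.1 * (X - 1) ^ ij.2 : F[X]))).card ≤ (m + 1) ^ 2 :=
    Finset.card_image_le.trans (by simp [sq])
  rw [twoRootForms, add_mul, one_mul]
  refine (Finset.card_union_le _ _).trans (Nat.add_le_add ?_ ?_)
  · convert h1.trans (Nat.le_mul_of_pos_right _ (Nat.pow_pos hq))
  · split_ifs with h4
    · refine Finset.card_image_le.trans ?_
      exact Nat.le_self_pow (by omega) _
    · simp

lemma exists_mem_twoRootForms [Fintype F] [CharP F 2] {K : Type*} [Field K] [Algebra F K]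
    [IsAlgClosed K] (hg : 2 ≤ g) (f : {f : F[X] // f.Monic ∧ f.natDegree ≤ g + 1})
    (h : {x : OnePoint K | IsProjRoot (g + 1) (f : F[X]) x}.ncard ≤ 2) :
    ∃ h : {f : F[X] // f.Monic ∧ f.natDegree ≤ g + 1},
      Quot.mk (psiEquiv g) f = Quot.mk (psiEquiv g) h ∧ (h : F[X]) ∈ twoRootForms F (g + 1) := by
  classical
  obtain ⟨f, hfm, hfd⟩ := f
  dsimp only at h
  have himg : (((↑) : K → OnePoint K) '' f.rootSet K) ⊆ {x | IsProjRoot (g + 1) f x} := by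
    rintro _ ⟨t, ht, rfl⟩
    exact isProjRoot_coe.2 (mem_rootSet.1 ht).2
  have hfin := setOf_isProjRoot_finite (K := K) hfm.ne_zero (g + 1)
  have hcard : (((↑) : K → OnePoint K) '' f.rootSet K).ncard = (f.rootSet K).ncard :=
    Set.ncard_image_of_injective _ OnePoint.coe_injective
  have hN : (f.rootSet K).ncard ≤ 2 := hcard ▸ (Set.ncard_le_ncard himg hfin).trans h
  rcases exists_form_of_ncard_rootSet_le_two hfm hN with
    ⟨a, b, i, j, hab, rfl⟩ | ⟨b, c, k, hb, h2, rfl⟩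
  · have hX1 : (X - 1 : F[X]) = X - C 1 := by simp
    have hmon : (X ^ i * (X - 1) ^ j : F[X]).Monic := by
      rw [hX1]; exact (monic_X_pow i).mul ((monic_X_sub_C 1).pow j)
    have hd : i + j ≤ g + 1 := by
      rw [((monic_X_sub_C a).pow i).natDegree_mul ((monic_X_sub_C b).pow j)] at hfd
      simpa using hfd
    have hdeg : (X ^ i * (X - 1) ^ j : F[X]).natDegree ≤ g + 1 := by
      rw [hX1, (monic_X_pow i).natDegree_mul ((monic_X_sub_C 1).pow j)]
      simpa [-map_one] using hd
    refine ⟨⟨X ^ i * (X - 1) ^ j, hmon, hdeg⟩, mk_psiEquiv_eq_of_comp (u := b - a) (s := a)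
      (c := (b - a) ^ (i + j)) (sub_ne_zero.2 hab.symm) (pow_ne_zero _ (sub_ne_zero.2 hab.symm)) ?_,
      ?_⟩
    · simp only [mul_comp, pow_comp, sub_comp, X_comp, C_comp, C_pow, C_sub]
      rw [show (C b - C a) * X + C a - C a = (C b - C a) * X by ring,
        show (C b - C a) * X + C a - C b = (C b - C a) * (X - 1) by ring, mul_pow, mul_pow]
      ring
    · refine Finset.mem_union_left _ (Finset.mem_image.2 ⟨(i, j), ?_, rfl⟩)
      simp
      omega
  · have hmono : ∀ b c : F, (X ^ 2 + C b * X + C c).Monic := fun b c => by monicity!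
    have hdq : ∀ b c : F, (X ^ 2 + C b * X + C c).natDegree = 2 := fun b c => by compute_degree!
    have hinf : ¬ IsProjRoot (g + 1) ((X ^ 2 + C b * X + C c) ^ k) (∞ : OnePoint K) := by
      intro hinf
      have hmem : ∞ ∈ {x : OnePoint K | IsProjRoot (g + 1) ((X ^ 2 + C b * X + C c) ^ k) x} := hinf
      have := Set.ncard_le_ncard (Set.insert_subset hmem himg) hfin
      rw [Set.ncard_insert_of_notMem (by simp), hcard, h2] at this
      omega
    have hk : 2 * k = g + 1 := by
      rw [isProjRoot_infty] at hinf
      have h1 := le_natDegree_of_ne_zero hinf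
      have h2 := (hmono b c).natDegree_pow k
      rw [hdq] at h2
      omega
    have hX1 : (X ^ 2 + X + C (c / b ^ 2) : F[X]) = X ^ 2 + C 1 * X + C (c / b ^ 2) := by simp
    have hmon : ((X ^ 2 + X + C (c / b ^ 2) : F[X]) ^ k).Monic := by
      rw [hX1]; exact (hmono _ _).pow k
    have hdeg : ((X ^ 2 + X + C (c / b ^ 2) : F[X]) ^ k).natDegree ≤ g + 1 := by
      rw [hX1, (hmono _ _).natDegree_pow, hdq]
      omega
    refine ⟨⟨(X ^ 2 + X + C (c / b ^ 2)) ^ k, hmon, hdeg⟩, mk_psiEquiv_eq_of_comp (u := b) (s := 0)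
      (c := (b ^ 2) ^ k) hb (pow_ne_zero _ (pow_ne_zero _ hb)) ?_, ?_⟩
    · have hc : C (b ^ 2) * C (c / b ^ 2) = C c := by
        rw [← C_mul, mul_div_cancel₀ _ (pow_ne_zero _ hb)]
      simp only [mul_comp, pow_comp, add_comp, X_comp, C_comp, C_0, add_zero]
      rw [C_pow, ← mul_pow, mul_add, hc, C_pow]
      ring
    · refine Finset.mem_union_right _ ?_
      rw [if_pos (by omega)]
      exact Finset.mem_image.2 ⟨c / b ^ 2, Finset.mem_univ _, by
        rw [show (g + 1) / 2 = k by omega]⟩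

end NormalForms

section Counting

variable {F : Type*} [Field F] {K : Type*} [Field K] [Algebra F K]

open scoped Classical in
lemma card_filter_psi_eq_le [Fintype F] [Infinite K] {m : ℕ} (hm : m ≠ 0)
    (hgcd : Nat.gcd m (Fintype.card F - 1) = 1) {f : F[X]} (hf : f.natDegree ≤ m) (hf0 : f ≠ 0)
    {x : Fin 3 → OnePoint K} (hx : Function.Injective x) (hroot : ∀ i, IsProjRoot m f (x i))
    (h : F[X]) :
    (Finset.univ.filter fun A : GL (Fin 2) F =>
      psi m (A : Matrix (Fin 2) (Fin 2) F) f = h).card ≤ (m + 1) ^ 3 := by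
  by_cases hne : ∃ A : GL (Fin 2) F, psi m (A : Matrix (Fin 2) (Fin 2) F) f = h
  swap
  · rw [Finset.filter_false_of_mem fun A _ hA => hne ⟨A, hA⟩]
    simp
  obtain ⟨A₀, hA₀⟩ := hne
  have hh0 : h ≠ 0 := hA₀ ▸ psi_ne_zero (K := K) hf hf0 A₀
  have hhd : h.natDegree ≤ m := hA₀ ▸ natDegree_psi_le m _ f
  have hfin := setOf_isProjRoot_finite (K := K) hh0 m
  have hR : hfin.toFinset.card ≤ m + 1 := by
    rw [← Set.ncard_eq_toFinset_card _ hfin]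
    exact ncard_setOf_isProjRoot_le hh0 hhd
  calc _ ≤ (Fintype.piFinset fun _ : Fin 3 => hfin.toFinset).card := by
        refine Finset.card_le_card_of_injOn
          (fun A i => (A.map (algebraMap F K))⁻¹ • x i) ?_ ?_
        · intro A hA
          have hA : psi m (A : Matrix (Fin 2) (Fin 2) F) f = h := by simpa using hA
          rw [Finset.mem_coe, Fintype.mem_piFinset]
          intro i
          rw [Set.Finite.mem_toFinset, Set.mem_ofPred_eq, ← hA, isProjRoot_psi_iff hf,
            smul_inv_smul]
          exact hroot i
        · intro A hA B hB hAB
          have hA : psi m (A : Matrix (Fin 2) (Fin 2) F) f = h := by simpa using hA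
          have hB : psi m (B : Matrix (Fin 2) (Fin 2) F) f = h := by simpa using hB
          obtain ⟨s, hs⟩ := eq_mul_of_smul_eq_of_three hx (fun i => congrFun hAB i)
          have hsm : s ^ m = 1 := by
            rw [psi_eq_pow_smul_of_eq_mul m hs, hA] at hB
            exact C_injective (mul_right_cancel₀ hh0 (by rw [hB, C_1, one_mul]))
          have hs0 : s ≠ 0 := by
            rintro rfl
            simp [hm] at hsm
          have hs1 : s = 1 := by
            rw [← pow_one s, ← hgcd]
            exact pow_gcd_eq_one.2 ⟨hsm, FiniteField.pow_card_sub_one_eq_one s hs0⟩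
          ext i j
          simp [hs, hs1]
    _ ≤ (m + 1) ^ 3 := by
        simpa using Nat.pow_le_pow_left hR 3

lemma card_pow_four_le_four_mul_card_GL [Fintype F] :
    Fintype.card F ^ 4 ≤ 4 * Nat.card (GL (Fin 2) F) := by
  have hq : 2 ≤ Fintype.card F := Fintype.one_lt_card
  rw [Matrix.card_GL_field, Fin.prod_univ_two]
  set q := Fintype.card F
  have h1 : q ^ 2 ≤ 2 * (q ^ 2 - 1) := by
    have : 2 ≤ q ^ 2 := by nlinarith
    omega
  have h2 : q ^ 2 ≤ 2 * (q ^ 2 - q) := by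
    have : 2 * q ≤ q ^ 2 := by nlinarith
    omega
  calc q ^ 4 = q ^ 2 * q ^ 2 := by ring
    _ ≤ (2 * (q ^ 2 - 1)) * (2 * (q ^ 2 - q)) := Nat.mul_le_mul h1 h2
    _ = _ := by simp; ring

lemma quot_mk_eq_of_psi_eq {g : ℕ} [Infinite K]
    (f h : {f : F[X] // f.Monic ∧ f.natDegree ≤ g + 1}) {A B : GL (Fin 2) F}
    (hAB : psi (g + 1) (A : Matrix (Fin 2) (Fin 2) F) (f : F[X]) =
      psi (g + 1) (B : Matrix (Fin 2) (Fin 2) F) (h : F[X])) :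
    Quot.mk (psiEquiv g) f = Quot.mk (psiEquiv g) h := by
  classical
  set p := psi (g + 1) (A : Matrix (Fin 2) (Fin 2) F) (f : F[X]) with hp
  have hp0 : p ≠ 0 := psi_ne_zero (K := K) f.2.2 f.2.1.ne_zero A
  have hlc : p.leadingCoeff⁻¹ ≠ 0 := inv_ne_zero (leadingCoeff_ne_zero.2 hp0)
  let r : {f : F[X] // f.Monic ∧ f.natDegree ≤ g + 1} :=
    ⟨p.leadingCoeff⁻¹ • p, by
      rw [smul_eq_C_mul, mul_comm]; exact monic_mul_leadingCoeff_inv hp0,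
      (natDegree_smul_le _ _).trans (natDegree_psi_le _ _ _)⟩
  have h1 : Quot.mk (psiEquiv g) f = Quot.mk (psiEquiv g) r :=
    Quot.sound ⟨A, Units.mk0 _ hlc, rfl⟩
  have h2 : Quot.mk (psiEquiv g) h = Quot.mk (psiEquiv g) r :=
    Quot.sound ⟨B, Units.mk0 _ hlc, by rw [← hAB]; rfl⟩
  rw [h1, h2]

lemma finite_monic_natDegree_le [Finite F] (m : ℕ) :
    Finite {f : F[X] // f.Monic ∧ f.natDegree ≤ m} := by
  refine Finite.of_injective
    (fun (f : {f : F[X] // f.Monic ∧ f.natDegree ≤ m}) (i : Fin (m + 1)) => (f : F[X]).coeff i)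
    fun f h hfh => Subtype.ext ?_
  refine (ext_iff_natDegree_le f.2.2 h.2.2).2 fun i hi => ?_
  exact congrFun hfh ⟨i, Nat.lt_succ_of_le hi⟩

open scoped Classical in
lemma card_quot_three_roots_le [Fintype F] [Infinite K] {g : ℕ} (hg : 2 ≤ g)
    (hgcd : Nat.gcd (g + 1) (Fintype.card F - 1) = 1)
    (S : Finset (Quot (psiEquiv g (F := F))))
    (hS : ∀ q ∈ S, ∃ x : Fin 3 → OnePoint K, Function.Injective x ∧
      ∀ i, IsProjRoot (g + 1) (q.out : F[X]) (x i)) :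
    S.card ≤ 4 * (g + 2) ^ 3 * Fintype.card F ^ (g - 2) := by
  have key : (S ×ˢ (Finset.univ : Finset (GL (Fin 2) F))).card ≤
      (g + 2) ^ 3 * (Finset.univ : Finset (Fin (g + 2) → F)).card := by
    refine Finset.card_le_mul_card_image_of_maps_to
      (f := fun qA (i : Fin (g + 2)) =>
        (psi (g + 1) (qA.2 : Matrix (Fin 2) (Fin 2) F) (qA.1.out : F[X])).coeff i)
      (fun _ _ => Finset.mem_univ _) _ fun b _ => ?_
    rcases Finset.eq_empty_or_nonempty ((S ×ˢ (Finset.univ : Finset (GL (Fin 2) F))).filter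
      fun qA => (fun i : Fin (g + 2) =>
        (psi (g + 1) (qA.2 : Matrix (Fin 2) (Fin 2) F) (qA.1.out : F[X])).coeff i) = b) with
      h0 | ⟨⟨q₀, A₀⟩, h0⟩
    · rw [h0]; simp
    · simp only [Finset.mem_filter, Finset.mem_product, Finset.mem_univ, and_true] at h0
      obtain ⟨hq₀, hb⟩ := h0
      obtain ⟨x, hx, hroot⟩ := hS q₀ hq₀
      have hsame : ∀ (q : Quot (psiEquiv g (F := F))) (A : GL (Fin 2) F),
          (fun i : Fin (g + 2) =>
            (psi (g + 1) (A : Matrix (Fin 2) (Fin 2) F) (q.out : F[X])).coeff i) = b →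
          psi (g + 1) (A : Matrix (Fin 2) (Fin 2) F) (q.out : F[X]) =
            psi (g + 1) (A₀ : Matrix (Fin 2) (Fin 2) F) (q₀.out : F[X]) := fun q A hqA => by
        refine (ext_iff_natDegree_le (natDegree_psi_le _ _ _) (natDegree_psi_le _ _ _)).2
          fun i hi => ?_
        exact congrFun (hqA.trans hb.symm) ⟨i, Nat.lt_succ_of_le hi⟩
      have hq : ∀ (q : Quot (psiEquiv g (F := F))) (A : GL (Fin 2) F),
          psi (g + 1) (A : Matrix (Fin 2) (Fin 2) F) (q.out : F[X]) =
            psi (g + 1) (A₀ : Matrix (Fin 2) (Fin 2) F) (q₀.out : F[X]) → q = q₀ :=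
        fun q A hqA => by
          have := quot_mk_eq_of_psi_eq (K := K) q.out q₀.out hqA
          rwa [Quot.out_eq, Quot.out_eq] at this
      refine le_trans ?_ (card_filter_psi_eq_le (K := K) (Nat.succ_ne_zero g) hgcd q₀.out.2.2
        q₀.out.2.1.ne_zero hx hroot
        (psi (g + 1) (A₀ : Matrix (Fin 2) (Fin 2) F) (q₀.out : F[X])))
      refine Finset.card_le_card_of_injOn Prod.snd ?_ ?_
      · rintro ⟨q, A⟩ hqA
        simp only [Finset.coe_filter, Finset.mem_product, Finset.mem_univ, and_true,
          Set.mem_ofPred_eq] at hqA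
        have h1 := hsame q A hqA.2
        have h2 := hq q A h1
        subst h2
        simpa using h1
      · rintro ⟨q, A⟩ hqA ⟨q', A'⟩ hqA' hAA'
        simp only [Finset.coe_filter, Finset.mem_product, Finset.mem_univ, and_true,
          Set.mem_ofPred_eq] at hqA hqA'
        exact Prod.ext ((hq q A (hsame q A hqA.2)).trans (hq q' A' (hsame q' A' hqA'.2)).symm) hAA'
  rw [Finset.card_product, Finset.card_univ, Finset.card_univ, Fintype.card_fun,
    Fintype.card_fin, ← Nat.card_eq_fintype_card (α := GL (Fin 2) F)] at key
  have hGL := card_pow_four_le_four_mul_card_GL (F := F)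
  have hq4 : 0 < Fintype.card F ^ 4 := Nat.pow_pos Fintype.card_pos
  refine Nat.le_of_mul_le_mul_right ?_ hq4
  calc S.card * Fintype.card F ^ 4 ≤ S.card * (4 * Nat.card (GL (Fin 2) F)) :=
        Nat.mul_le_mul_left _ hGL
    _ = 4 * (S.card * Nat.card (GL (Fin 2) F)) := by ring
    _ ≤ 4 * ((g + 2) ^ 3 * Fintype.card F ^ (g + 2)) := Nat.mul_le_mul_left _ key
    _ = 4 * (g + 2) ^ 3 * Fintype.card F ^ (g - 2) * Fintype.card F ^ 4 := by
        rw [show g + 2 = (g - 2) + 4 by omega, pow_add (Fintype.card F)]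
        ring

lemma card_quot_two_roots_le [Fintype F] [CharP F 2] [IsAlgClosed K] {g : ℕ} (hg : 2 ≤ g)
    (S : Finset (Quot (psiEquiv g (F := F))))
    (hS : ∀ q ∈ S, {x : OnePoint K | IsProjRoot (g + 1) (q.out : F[X]) x}.ncard ≤ 2) :
    S.card ≤ ((g + 2) ^ 2 + 1) * Fintype.card F ^ (g - 2) := by
  refine le_trans ?_ (card_twoRootForms_le (F := F) (g + 1))
  have hex : ∀ q ∈ S, ∃ h : {f : F[X] // f.Monic ∧ f.natDegree ≤ g + 1},
      q = Quot.mk (psiEquiv g) h ∧ (h : F[X]) ∈ twoRootForms F (g + 1) := fun q hq => by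
    obtain ⟨h, h1, h2⟩ := exists_mem_twoRootForms hg q.out (hS q hq)
    exact ⟨h, by rw [← h1, Quot.out_eq], h2⟩
  have : Nonempty {f : F[X] // f.Monic ∧ f.natDegree ≤ g + 1} := ⟨1, monic_one, by simp⟩
  choose! φ hφ hφ' using hex
  refine Finset.card_le_card_of_injOn (fun q => (φ q : F[X])) hφ' fun q hq q' hq' h => ?_
  rw [hφ q hq, hφ q' hq', Subtype.ext h]

theorem card_quot_psiEquiv_le [Fintype F] [CharP F 2] {g : ℕ} (hg : 2 ≤ g)
    (hgcd : Nat.gcd (g + 1) (Fintype.card F - 1) = 1) :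
    Nat.card (Quot (psiEquiv g (F := F))) ≤
      (4 * (g + 2) ^ 3 + ((g + 2) ^ 2 + 1)) * Fintype.card F ^ (g - 2) := by
  classical
  have := finite_monic_natDegree_le (F := F) (g + 1)
  have := Fintype.ofFinite (Quot (psiEquiv g (F := F)))
  have : Infinite (AlgebraicClosure F) := IsAlgClosed.instInfinite
  let P : Quot (psiEquiv g (F := F)) → Prop := fun q =>
    {x : OnePoint (AlgebraicClosure F) | IsProjRoot (g + 1) (q.out : F[X]) x}.ncard ≤ 2
  rw [Nat.card_eq_fintype_card, ← Finset.card_univ,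
    ← Finset.card_filter_add_card_filter_not (s := Finset.univ) P, add_comm, add_mul]
  refine Nat.add_le_add (card_quot_three_roots_le (K := AlgebraicClosure F) hg hgcd _ ?_)
    (card_quot_two_roots_le (K := AlgebraicClosure F) hg _ ?_)
  · intro q hq
    have hq := (Finset.mem_filter.1 hq).2
    have hfin := setOf_isProjRoot_finite (K := AlgebraicClosure F) q.out.2.1.ne_zero (g + 1)
    obtain ⟨a, b, c, ha, hb, hc, hab, hac, hbc⟩ := (Set.two_lt_ncard_iff hfin).1 (not_le.1 hq)
    refine ⟨![a, b, c], ?_, ?_⟩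
    · intro i j hij
      fin_cases i <;> fin_cases j <;> simp_all
    · intro i
      fin_cases i
      exacts [ha, hb, hc]
  · intro q hq
    exact (Finset.mem_filter.1 hq).2

end Counting

theorem count_orbits_of_monic_polys (g : ℕ) (hg : 2 ≤ g) :
    ∃ C : ℝ, 0 < C ∧ ∀ n : ℕ, 1 ≤ n → Nat.gcd (g + 1) (2 ^ n - 1) = 1 →
      (Nat.card (Quot (psiEquiv g (F := GaloisField 2 n))) : ℝ) ≤
        C * 2 ^ (n * (g - 2)) := by
  refine ⟨((4 * (g + 2) ^ 3 + ((g + 2) ^ 2 + 1) : ℕ) : ℝ), by positivity, fun n hn hgcd => ?_⟩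
  have := Fintype.ofFinite (GaloisField 2 n)
  have hcard : Fintype.card (GaloisField 2 n) = 2 ^ n := by
    rw [← Nat.card_eq_fintype_card, GaloisField.card 2 n (by omega)]
  have key := card_quot_psiEquiv_le (F := GaloisField 2 n) hg (by rwa [hcard])
  rw [hcard, ← pow_mul] at key
  exact_mod_cast key
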